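/- Let r be a prime and let L = PSL_n(q) be simple (i.e., (n,q) is not (2,2) or (2,3)). Then the set of element orders of the direct product Z_r × L, where Z_r is a cyclic group of order r, is not contained in the set of element orders of L; that is, some element of Z_r × L has order that is not the order of any element of L. -/

import Mathlib

/-- The spectrum of a group: the set of orders of its elements. -/
def groupSpectrum (G : Type*) [Group G] : Set ℕ := {k | ∃ g : G, orderOf g = k}

open Polynomial

theorem exists_prime_pow_dvd_of_not_cyclotomic {q n N : ℕ} (hq : 2 ≤ q) (hn : 2 ≤ n)
    (hN : N ∣ q ^ n - 1)
    (h : ¬ N * ((cyclotomic n ℤ).eval (q : ℤ)).natAbs ∣ q ^ n - 1) :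
    ∃ l b : ℕ, l.Prime ∧ l ^ b ∣ N ∧ ∀ i, 0 < i → i < n → ¬ l ^ b ∣ q ^ i - 1 := by
  by_contra! hc
  apply h
  have hcast : ∀ j : ℕ, ((q ^ j - 1 : ℕ) : ℤ) = (q : ℤ) ^ j - 1 := fun j => by
    rw [Nat.cast_sub (Nat.one_le_pow _ _ (by omega))]; simp
  have key : ∀ j ∈ n.properDivisors,
      (q ^ j - 1) * ((cyclotomic n ℤ).eval (q : ℤ)).natAbs ∣ q ^ n - 1 := by
    intro j hj
    have h1 := eval_dvd (x := (q : ℤ)) (X_pow_sub_one_mul_cyclotomic_dvd_X_pow_sub_one_of_dvd ℤ hj)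
    simp only [eval_mul, eval_sub, eval_pow, eval_X, eval_one, ← hcast] at h1
    have h2 := Int.natAbs_dvd_natAbs.2 h1
    rwa [Int.natAbs_mul, Int.natAbs_natCast, Int.natAbs_natCast] at h2
  have h1 : 1 ∈ n.properDivisors := by simp; omega
  have hpos : 0 < ((cyclotomic n ℤ).eval (q : ℤ)).natAbs :=
    (Nat.zero_le _).trans_lt (sub_one_lt_natAbs_cyclotomic_eval (by omega) (by omega))
  obtain ⟨M, hM⟩ := (dvd_mul_left _ _).trans (key 1 h1)
  rw [hM, mul_comm]
  refine mul_dvd_mul_left _ ?_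
  rw [Nat.dvd_iff_prime_pow_dvd_dvd]
  intro l b hl hb
  obtain ⟨i, hi, hin, hd⟩ := hc l b hl hb
  have hg : l ^ b ∣ q ^ Nat.gcd i n - 1 := by
    rw [← Nat.pow_sub_one_gcd_pow_sub_one]
    exact Nat.dvd_gcd hd (hb.trans hN)
  have hj : Nat.gcd i n ∈ n.properDivisors := by
    rw [Nat.mem_properDivisors]
    exact ⟨Nat.gcd_dvd_right _ _, (Nat.gcd_le_left _ hi).trans_lt hin⟩
  have := key _ hj
  rw [hM, mul_comm] at this
  exact hg.trans (Nat.dvd_of_mul_dvd_mul_left hpos this)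

theorem geom_sum_mul_nat (q n : ℕ) (hq : 1 ≤ q) :
    (∑ i ∈ Finset.range n, q ^ i) * (q - 1) = q ^ n - 1 := by
  obtain ⟨k, rfl⟩ := Nat.exists_eq_add_of_le' hq
  have := geom_sum_mul_add k n
  rw [Nat.add_sub_cancel]
  omega

theorem geom_sum_modEq (q n r : ℕ) (hq : 1 ≤ q) (hr : r ∣ q - 1) :
    (∑ i ∈ Finset.range n, q ^ i) ≡ n [MOD r] := by
  have h1 : q ≡ 1 [MOD r] := ((Nat.modEq_iff_dvd' hq).2 hr).symm
  induction n with
  | zero => rfl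
  | succ m ih => rw [Finset.sum_range_succ]; simpa using ih.add (h1.pow m)

theorem not_prime_dvd_both {q n r N₁ N₂ : ℕ} (hq : 2 ≤ q) (hn : 2 ≤ n) (hr : r.Prime)
    (h₁ : N₁ * Nat.gcd n (q - 1) = ∑ i ∈ Finset.range n, q ^ i)
    (h₂ : N₂ * Nat.gcd n (q - 1) = q ^ (n - 1) - 1) (hr₁ : r ∣ N₁) (hr₂ : r ∣ N₂) : False := by
  set d := Nat.gcd n (q - 1) with hd
  have hd0 : d ≠ 0 := by simp [hd]; omega
  have g1 := geom_sum_mul_nat q n (by omega)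
  have g2 := geom_sum_mul_nat q (n - 1) (by omega)
  have hrq : r ∣ q - 1 := by
    have e1 : r ∣ q ^ n - 1 := by
      rw [← g1, ← h₁]; exact ((hr₁.mul_right _).mul_right _)
    have e2 : r ∣ q ^ (n - 1) - 1 := by rw [← h₂]; exact hr₂.mul_right _
    have := Nat.dvd_gcd e1 e2
    rw [Nat.pow_sub_one_gcd_pow_sub_one] at this
    have h3 : Nat.gcd n (n - 1) = 1 := by
      have := (Nat.coprime_self_add_left (m := n - 1) (n := 1)).2 (by simp)
      rwa [Nat.sub_add_cancel (by omega)] at this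
    simpa [h3] using this
  have hrn : r ∣ n := by
    rw [← (geom_sum_modEq q n r (by omega) hrq).dvd_iff dvd_rfl, ← h₁]
    exact hr₁.mul_right _
  have hrn' : ¬ r ∣ ∑ i ∈ Finset.range (n - 1), q ^ i := by
    rw [(geom_sum_modEq q (n - 1) r (by omega) hrq).dvd_iff dvd_rfl]
    intro h
    have := (Nat.dvd_sub hrn h)
    rw [Nat.sub_sub_self (by omega)] at this
    exact hr.one_lt.ne' (Nat.dvd_one.1 this)
  set a := d.factorization r
  have hD : r ^ (a + 1) ∣ r * d := by
    rw [pow_succ']; exact mul_dvd_mul_left _ (Nat.ordProj_dvd d r)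
  have hDq : r ^ (a + 1) ∣ q - 1 := by
    have e : r ^ (a + 1) ∣ (∑ i ∈ Finset.range (n - 1), q ^ i) * (q - 1) := by
      rw [g2, ← h₂]; exact hD.trans (mul_dvd_mul_right hr₂ _)
    exact (Nat.Coprime.pow_left _ ((Nat.Prime.coprime_iff_not_dvd hr).2 hrn')).dvd_of_dvd_mul_left e
  have hDn : r ^ (a + 1) ∣ n := by
    rw [← (geom_sum_modEq q n _ (by omega) hDq).dvd_iff dvd_rfl, ← h₁]
    exact hD.trans (mul_dvd_mul_right hr₁ _)
  exact Nat.pow_succ_factorization_not_dvd hd0 hr (Nat.dvd_gcd hDn hDq)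

theorem exists_prime_pow_dvd_of_mul_gcd_eq_geom_sum {q n N : ℕ} (hq : 2 ≤ q) (hn : 2 ≤ n)
    (h23 : ¬ (n = 2 ∧ q = 3)) (h₁ : N * Nat.gcd n (q - 1) = ∑ i ∈ Finset.range n, q ^ i) :
    ∃ l b : ℕ, l.Prime ∧ l ^ b ∣ N ∧ ∀ i, 0 < i → i < n → ¬ l ^ b ∣ q ^ i - 1 := by
  set d := Nat.gcd n (q - 1) with hd
  have g1 := geom_sum_mul_nat q n (by omega)
  have hE : q ^ n - 1 = N * (d * (q - 1)) := by rw [← g1, ← h₁, mul_assoc]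
  have hqn : 0 < q ^ n - 1 := Nat.sub_pos_of_lt (Nat.one_lt_pow (by omega) (by omega))
  have hN0 : 0 < N := by
    rcases Nat.eq_zero_or_pos N with rfl | h
    · simp at hE; omega
    · exact h
  refine exists_prime_pow_dvd_of_not_cyclotomic hq hn ⟨_, hE⟩ fun h => ?_
  rw [hE] at h
  have h := Nat.dvd_of_mul_dvd_mul_left hN0 h
  have hdq : d ≤ q - 1 := Nat.gcd_le_right _ (by omega)
  have hd0 : 0 < d := Nat.gcd_pos_of_pos_left _ (by omega)
  have hle := Nat.le_of_dvd (Nat.mul_pos hd0 (by omega)) h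
  rcases hn.eq_or_lt with rfl | hn
  · simp only [cyclotomic_two, eval_add, eval_X, eval_one] at h hle
    have : ((q : ℤ) + 1).natAbs = q + 1 := by omega
    rw [this] at h hle
    have hd2 : d ∣ 2 := Nat.gcd_dvd_left _ _
    rcases (Nat.dvd_prime Nat.prime_two).1 hd2 with h1 | h1
    · rw [h1] at hle; omega
    · rw [h1] at h
      have h4 : q + 1 ∣ 4 := by
        have := Nat.dvd_sub (dvd_mul_left (q + 1) 2) h
        rwa [show 2 * (q + 1) - 2 * (q - 1) = 4 by omega] at this
      have hq4 := Nat.le_of_dvd (by norm_num) h4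
      have hq2 : q = 2 := by omega
      rw [hq2] at h4
      omega
  · have h2 : 2 ≤ n.totient := by
      have := Nat.totient_pos.2 (show 0 < n by omega)
      obtain ⟨k, hk⟩ := Nat.totient_even hn
      omega
    have := sub_one_pow_totient_lt_natAbs_cyclotomic_eval (n := n) (q := q) (by omega) (by omega)
    have h3 : (q - 1) ^ 2 ≤ (q - 1) ^ n.totient := Nat.pow_le_pow_right (by omega) h2
    have h4 : d * (q - 1) ≤ (q - 1) ^ 2 := by rw [sq]; exact Nat.mul_le_mul_right _ hdq
    omega

theorem exists_prime_pow_dvd_of_mul_eq_pow_sub_one {q n N d : ℕ} (hq : 2 ≤ q) (hn : 2 ≤ n) (hd : d ∣ q - 1)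
    (h₁ : N * d = q ^ n - 1) :
    ∃ l b : ℕ, l.Prime ∧ l ^ b ∣ N ∧ ∀ i, 0 < i → i < n → ¬ l ^ b ∣ q ^ i - 1 := by
  have hqn : 0 < q ^ n - 1 := Nat.sub_pos_of_lt (Nat.one_lt_pow (by omega) (by omega))
  have hN0 : 0 < N := by
    rcases Nat.eq_zero_or_pos N with rfl | h
    · simp at h₁; omega
    · exact h
  refine exists_prime_pow_dvd_of_not_cyclotomic hq hn ⟨_, h₁.symm⟩ fun h => ?_
  rw [← h₁] at h
  have h := (Nat.dvd_of_mul_dvd_mul_left hN0 h).trans hd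
  have hle := Nat.le_of_dvd (by omega) h
  have := sub_one_lt_natAbs_cyclotomic_eval (n := n) (q := q) (by omega) (by omega)
  omega

section
variable {F : Type*} [Field F]

theorem dvd_X_pow_mul_sub_C {f : F[X]} {m : ℕ} {c : F} (h : f ∣ X ^ m - C c) (k : ℕ) :
    f ∣ X ^ (m * k) - C (c ^ k) := by
  rw [pow_mul, C_pow]
  exact h.trans (sub_dvd_pow_sub_pow _ _ k)

theorem eq_of_dvd_X_pow_sub_C {f : F[X]} (hf : ¬ IsUnit f) {m : ℕ} {a b : F}
    (ha : f ∣ X ^ m - C a) (hb : f ∣ X ^ m - C b) : a = b := by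
  by_contra hab
  apply hf
  have h := dvd_sub hb ha
  rw [sub_sub_sub_cancel_left, ← C_sub] at h
  exact isUnit_of_dvd_unit h (isUnit_C.2 (sub_ne_zero.2 hab).isUnit)

variable [Finite F]

theorem exists_algebraMap_eq_of_pow_eq_one {K : Type*} [Field K] [Algebra F K] {x : K}
    (hx : x ^ (Nat.card F - 1) = 1) : ∃ c : F, algebraMap F K c = x := by
  have := Fintype.ofFinite F
  rw [Nat.card_eq_fintype_card] at hx
  have hs : (X ^ Fintype.card F - X : F[X]).Splits := by
    rw [splits_iff_card_roots, FiniteField.roots_X_pow_card_sub_X,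
      FiniteField.X_pow_card_sub_X_natDegree_eq F Fintype.one_lt_card]
    rfl
  have hx' : aeval x (X ^ Fintype.card F - X : F[X]) = 0 := by
    have h1 : Fintype.card F = Fintype.card F - 1 + 1 := by have := Fintype.card_pos (α := F); omega
    rw [map_sub, map_pow, aeval_X, h1, pow_succ, hx, one_mul, sub_self]
  exact hs.mem_range_of_isRoot (FiniteField.X_pow_card_sub_X_ne_zero F Fintype.one_lt_card)
    (by rwa [IsRoot, eval_map_algebraMap])

theorem Irreducible.exists_dvd_X_pow_sub_C {f : F[X]} (hf : Irreducible f) {m : ℕ}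
    (h : f ∣ X ^ (m * (Nat.card F - 1)) - 1) : ∃ c : F, f ∣ X ^ m - C c := by
  have : Fact (Irreducible f) := ⟨hf⟩
  have h1 : (AdjoinRoot.root f ^ m) ^ (Nat.card F - 1) = 1 := by
    have := AdjoinRoot.mk_eq_zero.2 h
    simpa [sub_eq_zero, pow_mul] using this
  obtain ⟨c, hc⟩ := exists_algebraMap_eq_of_pow_eq_one h1
  refine ⟨c, AdjoinRoot.mk_eq_zero.1 ?_⟩
  rw [AdjoinRoot.algebraMap_eq] at hc
  simp [hc]

theorem Irreducible.dvd_X_pow_geom_sum_sub_C {f : F[X]} (hf : Irreducible f) (hm : f.Monic) :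
    f ∣ X ^ (∑ i ∈ Finset.range f.natDegree, Nat.card F ^ i) -
      C ((-1) ^ f.natDegree * f.coeff 0) := by
  have : Fact (Irreducible f) := ⟨hf⟩
  let pb := AdjoinRoot.powerBasis hf.ne_zero
  have : Module.Finite F (AdjoinRoot f) := pb.finite
  have : Finite (AdjoinRoot f) := Module.finite_of_finite F
  have h1 := FiniteField.algebraMap_norm_eq_pow_sum F (AdjoinRoot f) pb.gen
  have hfr : Module.finrank F (AdjoinRoot f) = f.natDegree := by
    rw [pb.finrank, AdjoinRoot.powerBasis_dim]
  rw [Algebra.PowerBasis.norm_gen_eq_coeff_zero_minpoly, AdjoinRoot.minpoly_powerBasis_gen_of_monic hm,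
    hfr, AdjoinRoot.powerBasis_dim, AdjoinRoot.powerBasis_gen, AdjoinRoot.algebraMap_eq] at h1
  refine AdjoinRoot.mk_eq_zero.1 ?_
  rw [map_sub, map_pow, AdjoinRoot.mk_X, AdjoinRoot.mk_C, h1, sub_self]

theorem Irreducible.dvd_X_pow_card_pow_natDegree_sub_one {f : F[X]} (hf : Irreducible f)
    (hX : ¬ f ∣ X) : f ∣ X ^ (Nat.card F ^ f.natDegree - 1) - 1 := by
  have h := hf.natDegree_dvd_iff_dvd_X_pow_card_pow_sub_X.1 dvd_rfl
  have h1 : Nat.card F ^ f.natDegree = Nat.card F ^ f.natDegree - 1 + 1 := by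
    have := Nat.pow_pos (n := f.natDegree) (Nat.card_pos (α := F)); omega
  rw [h1, pow_succ, ← sub_one_mul] at h
  exact (hf.prime.dvd_or_dvd h).resolve_right hX

end

theorem Nat.Prime.pow_dvd_or_of_dvd_lcm {l b x y : ℕ} (hl : l.Prime) (h : l ^ b ∣ x.lcm y) :
    l ^ b ∣ x ∨ l ^ b ∣ y := by
  rcases eq_or_ne x 0 with rfl | hx
  · simp
  rcases eq_or_ne y 0 with rfl | hy
  · simp
  rw [hl.pow_dvd_iff_le_factorization (Nat.lcm_ne_zero hx hy), Nat.factorization_lcm hx hy,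
    Finsupp.sup_apply, le_sup_iff] at h
  rwa [hl.pow_dvd_iff_le_factorization hx, hl.pow_dvd_iff_le_factorization hy]

theorem exists_dvd_X_pow_sub_one_pow {F : Type*} [Field F] [Finite F] {l b : ℕ} (hl : l.Prime)
    (hb : b ≠ 0) (g : F[X]) (hg : g ≠ 0) (hX : ¬ X ∣ g)
    (h : ∀ f : F[X], Irreducible f → f ∣ g → ¬ l ^ b ∣ Nat.card F ^ f.natDegree - 1) :
    ∃ T c : ℕ, ¬ l ^ b ∣ T ∧ g ∣ (X ^ T - 1) ^ c := by
  induction g using UniqueFactorizationMonoid.induction_on_prime with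
  | h₁ => exact absurd rfl hg
  | h₂ g hu => exact ⟨1, 0, by simp [hb, hl.ne_one], by simpa using hu.dvd⟩
  | h₃ g f hg0 hf ih =>
    obtain ⟨T, c, hT, hd⟩ := ih hg0 (fun hx => hX (hx.mul_left f))
      (fun f' hf' hd => h f' hf' (hd.mul_left f))
    have hfX : ¬ f ∣ X := fun hfX =>
      hX (((hf.irreducible.associated_of_dvd irreducible_X hfX).symm.dvd).mul_right g)
    have hT' := h f hf.irreducible (dvd_mul_right f g)
    refine ⟨(Nat.card F ^ f.natDegree - 1).lcm T, c + 1,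
      fun hc => (hl.pow_dvd_or_of_dvd_lcm hc).elim hT' hT, ?_⟩
    rw [pow_succ']
    have hmono : ∀ {s t : ℕ}, s ∣ t → (X ^ s - 1 : F[X]) ∣ X ^ t - 1 := fun {s t} hst => by
      obtain ⟨u, rfl⟩ := hst
      rw [pow_mul]; simpa using sub_dvd_pow_sub_pow (X ^ s : F[X]) 1 u
    exact mul_dvd_mul
      ((hf.irreducible.dvd_X_pow_card_pow_natDegree_sub_one hfX).trans
        (hmono (Nat.dvd_lcm_left _ _)))
      (hd.trans (pow_dvd_pow_of_dvd (hmono (Nat.dvd_lcm_right _ _)) c))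

section
variable {ι F : Type*} [Fintype ι] [DecidableEq ι] [Field F]

theorem Matrix.pow_eq_scalar_of_charpoly_dvd {M : Matrix ι ι F} {m : ℕ} {c : F}
    (h : M.charpoly ∣ X ^ m - C c) : M ^ m = Matrix.scalar ι c := by
  have := aeval_eq_zero_of_dvd_aeval_eq_zero h M.aeval_self_charpoly
  rw [map_sub, map_pow, aeval_X, aeval_C, sub_eq_zero] at this
  rw [this]; rfl

theorem Matrix.exists_irreducible_dvd_charpoly [Finite F] {p : ℕ} [Fact p.Prime] [CharP F p]
    {M : Matrix ι ι F} (hM : M.det ≠ 0) {l b : ℕ} (hl : l.Prime) (hb : b ≠ 0) (hlp : l ≠ p)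
    (h : l ^ b ∣ orderOf M) :
    ∃ f : F[X], Irreducible f ∧ f.Monic ∧ f ∣ M.charpoly ∧
      l ^ b ∣ Nat.card F ^ f.natDegree - 1 := by
  by_contra! hc
  have hX : ¬ X ∣ M.charpoly := by
    rw [X_dvd_iff]
    intro h0
    rw [Matrix.det_eq_sign_charpoly_coeff, h0, mul_zero] at hM
    exact hM rfl
  obtain ⟨T, c, hT, hd⟩ := exists_dvd_X_pow_sub_one_pow hl hb M.charpoly M.charpoly_monic.ne_zero hX
    fun f hf hd => by
      classical
      have := hc (normalize f) ((associated_normalize f).irreducible hf)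
        (monic_normalize hf.ne_zero) (normalize_dvd_iff.2 hd)
      rwa [natDegree_eq_of_degree_eq degree_normalize] at this
  have h1 : M.charpoly ∣ X ^ (T * p ^ c) - C 1 := by
    refine (hd.trans (pow_dvd_pow _ (Nat.lt_pow_self (Fact.out : p.Prime).one_lt (n := c)).le)).trans ?_
    rw [sub_pow_char_pow, pow_mul, one_pow, C_1]
  have h2 := Matrix.pow_eq_scalar_of_charpoly_dvd h1
  rw [map_one] at h2
  have h3 := h.trans (orderOf_dvd_of_pow_eq_one h2)
  refine hT (Nat.Coprime.dvd_of_dvd_mul_right ?_ h3)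
  exact Nat.Coprime.pow _ _ ((Nat.coprime_primes hl Fact.out).2 hlp)

theorem orderOf_mk_dvd_iff (g : Matrix.SpecialLinearGroup ι F) (k : ℕ) :
    orderOf (g : Matrix.ProjectiveSpecialLinearGroup ι F) ∣ k ↔
      ∃ c : F, (g : Matrix ι ι F) ^ k = Matrix.scalar ι c := by
  rw [orderOf_dvd_iff_pow_eq_one, ← QuotientGroup.mk_pow, QuotientGroup.eq_one_iff,
    Matrix.SpecialLinearGroup.mem_center_iff]
  constructor
  · rintro ⟨c, -, hc⟩
    exact ⟨c, by rw [hc]; simp⟩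
  · rintro ⟨c, hc⟩
    refine ⟨c, ?_, by rw [← hc]; simp⟩
    have := congrArg Matrix.det hc
    simpa using this.symm

theorem exists_orderOf_dvd_imp {V : Type*} [AddCommGroup V] [Module F V] [Module.Finite F V]
    (hV : Module.finrank F V = Fintype.card ι) (φ : Module.End F V) (hφ : LinearMap.det φ = 1) :
    ∃ g : Matrix.ProjectiveSpecialLinearGroup ι F, ∀ k, orderOf g ∣ k →
      ∃ c : F, φ ^ k = algebraMap F (Module.End F V) c := by
  let b : Module.Basis ι F V :=
    (Module.finBasisOfFinrankEq F V hV).reindex (Fintype.equivFin ι).symm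
  let e := LinearMap.toMatrixAlgEquiv b
  let g : Matrix.SpecialLinearGroup ι F :=
    ⟨e φ, by rw [← hφ]; exact LinearMap.det_toMatrix b φ⟩
  refine ⟨(g : Matrix.ProjectiveSpecialLinearGroup ι F), fun k hk => ?_⟩
  obtain ⟨c, hc⟩ := (orderOf_mk_dvd_iff g k).1 hk
  refine ⟨c, e.injective ?_⟩
  rw [map_pow, AlgEquiv.commutes]
  exact hc
end

section
variable {F : Type*} [Field F] [Finite F]

theorem exists_extension_generator (F : Type*) [Field F] [Finite F] (p : ℕ) [Fact p.Prime]
    [CharP F p] (m : ℕ) (hm : m ≠ 0) :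
    ∃ (K : Type) (_ : Field K) (_ : Finite K) (_ : Algebra F K) (_ : Module.Finite F K) (x : K),
      Module.finrank F K = m ∧ x ≠ 0 ∧ orderOf x = Nat.card F ^ m - 1 := by
  have : NeZero m := ⟨hm⟩
  obtain ⟨x, hx⟩ := IsCyclic.exists_generator (α := (FiniteField.Extension F p m)ˣ)
  refine ⟨FiniteField.Extension F p m, inferInstance, inferInstance, inferInstance, inferInstance,
    x, FiniteField.finrank_extension F p m, x.ne_zero, ?_⟩
  rw [orderOf_units, orderOf_eq_card_of_forall_mem_zpowers hx, Nat.card_units,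
    FiniteField.natCard_extension]

theorem pow_card_sub_one_eq_one_of_ne_zero {a : F} (ha : a ≠ 0) : a ^ (Nat.card F - 1) = 1 := by
  have := Fintype.ofFinite F
  rw [Nat.card_eq_fintype_card]
  exact FiniteField.pow_card_sub_one_eq_one a ha

theorem two_le_natCard : 2 ≤ Nat.card F := Finite.one_lt_card

theorem exists_dvd_orderOf_of_norm_one (p : ℕ) [Fact p.Prime] [CharP F p] {n N : ℕ} (hn : n ≠ 0)
    (hN : N * Nat.gcd n (Nat.card F - 1) = ∑ i ∈ Finset.range n, Nat.card F ^ i) :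
    ∃ g : Matrix.ProjectiveSpecialLinearGroup (Fin n) F, N ∣ orderOf g := by
  have hq := two_le_natCard (F := F)
  obtain ⟨K, _, _, _, _, x, hK, hx0, hx⟩ := exists_extension_generator F p n hn
  obtain ⟨g, hg⟩ := exists_orderOf_dvd_imp (ι := Fin n) (by simpa using hK)
    (Algebra.lmul F K (x ^ (Nat.card F - 1)))
    (show Algebra.norm F (x ^ (Nat.card F - 1)) = 1 by
      rw [map_pow]
      exact pow_card_sub_one_eq_one_of_ne_zero (Algebra.norm_ne_zero_iff.2 hx0))
  refine ⟨g, ?_⟩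
  obtain ⟨c, hc⟩ := hg _ dvd_rfl
  have h1 : (x ^ (Nat.card F - 1)) ^ orderOf g = algebraMap F K c := by
    have := congrArg (fun φ => φ 1) hc
    rw [← map_pow] at this
    simpa [Algebra.algebraMap_eq_smul_one] using this
  have hc0 : c ≠ 0 := by
    rintro rfl
    rw [map_zero] at h1
    exact pow_ne_zero _ (pow_ne_zero _ hx0) h1
  have h2 : x ^ ((Nat.card F - 1) * orderOf g * (Nat.card F - 1)) = 1 := by
    rw [pow_mul, pow_mul, h1, ← map_pow, pow_card_sub_one_eq_one_of_ne_zero hc0, map_one]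
  have h3 := orderOf_dvd_of_pow_eq_one h2
  rw [hx, ← geom_sum_mul_nat _ _ (by omega)] at h3
  have h4 := Nat.dvd_of_mul_dvd_mul_right (by omega) h3
  have hd0 : 0 < Nat.gcd n (Nat.card F - 1) := Nat.gcd_pos_of_pos_left _ (by omega)
  have hgcd : Nat.gcd (N * Nat.gcd n (Nat.card F - 1)) (Nat.card F - 1) =
      Nat.gcd n (Nat.card F - 1) := by
    rw [hN]; exact (geom_sum_modEq _ _ _ (by omega) dvd_rfl).gcd_eq
  have hcop := Nat.coprime_div_gcd_div_gcd (m := N * Nat.gcd n (Nat.card F - 1))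
    (n := Nat.card F - 1) (by rwa [hgcd])
  obtain ⟨e, he⟩ := Nat.gcd_dvd_right n (Nat.card F - 1)
  rw [hgcd, Nat.mul_div_cancel _ hd0, Nat.div_eq_of_eq_mul_right hd0 he] at hcop
  refine hcop.dvd_of_dvd_mul_left (Nat.dvd_of_mul_dvd_mul_right hd0 ?_)
  rw [hN]
  refine h4.trans (dvd_of_eq ?_)
  conv_lhs => rw [he]
  ring

theorem exists_dvd_orderOf_of_hyperplane (p : ℕ) [Fact p.Prime] [CharP F p] {n N : ℕ} (hn : 2 ≤ n)
    (hN : N * Nat.gcd n (Nat.card F - 1) = Nat.card F ^ (n - 1) - 1) :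
    ∃ g : Matrix.ProjectiveSpecialLinearGroup (Fin n) F, N ∣ orderOf g := by
  obtain ⟨K, _, _, _, _, x, hK, hx0, hx⟩ := exists_extension_generator F p (n - 1) (by omega)
  have hn0 : Algebra.norm F x ≠ 0 := Algebra.norm_ne_zero_iff.2 hx0
  obtain ⟨g, hg⟩ := exists_orderOf_dvd_imp (ι := Fin n) (V := K × F)
    (by rw [Module.finrank_prod, hK, Module.finrank_self, Fintype.card_fin]; omega)
    (LinearMap.prodMap (Algebra.lmul F K x) (Algebra.lmul F F (Algebra.norm F x)⁻¹))
    (by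
      rw [LinearMap.det_prodMap]
      change Algebra.norm F x * Algebra.norm F (Algebra.norm F x)⁻¹ = 1
      rw [Algebra.norm_self, MonoidHom.id_apply, mul_inv_cancel₀ hn0])
  refine ⟨g, ?_⟩
  obtain ⟨c, hc⟩ := hg _ dvd_rfl
  have hpow : ∀ k, (LinearMap.prodMap (Algebra.lmul F K x) (Algebra.lmul F F (Algebra.norm F x)⁻¹)) ^ k
      = LinearMap.prodMap (Algebra.lmul F K (x ^ k))
        (Algebra.lmul F F ((Algebra.norm F x)⁻¹ ^ k)) := by
    intro k
    induction k with
    | zero => ext <;> simp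
    | succ k ih => rw [pow_succ, ih, LinearMap.prodMap_mul, ← map_mul, ← map_mul, pow_succ, pow_succ]
  rw [hpow] at hc
  have h1 := congrArg (fun φ => φ ((1 : K), (1 : F))) hc
  simp only [LinearMap.prodMap_apply, Module.algebraMap_end_apply, Prod.smul_mk, Prod.mk.injEq] at h1
  obtain ⟨h1, h2⟩ := h1
  have h1 : x ^ orderOf g = algebraMap F K c := by
    simpa [Algebra.algebraMap_eq_smul_one] using h1
  have h2 : (Algebra.norm F x)⁻¹ ^ orderOf g = c := by simpa using h2
  have hc0 : c ≠ 0 := h2 ▸ pow_ne_zero _ (inv_ne_zero hn0)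
  have h3 : c ^ (n - 1) * c = 1 := by
    have := Algebra.norm_algebraMap (S := K) c
    rw [← h1, hK, map_pow] at this
    rw [← this, ← h2, ← mul_pow, mul_inv_cancel₀ hn0, one_pow]
  rw [← pow_succ, Nat.sub_add_cancel (by omega)] at h3
  have h4 : c ^ Nat.gcd n (Nat.card F - 1) = 1 :=
    orderOf_dvd_iff_pow_eq_one.1 (Nat.dvd_gcd (orderOf_dvd_of_pow_eq_one h3)
      (orderOf_dvd_of_pow_eq_one (pow_card_sub_one_eq_one_of_ne_zero hc0)))
  have h5 : x ^ (orderOf g * Nat.gcd n (Nat.card F - 1)) = 1 := by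
    rw [pow_mul, h1, ← map_pow, h4, map_one]
  have h6 := orderOf_dvd_of_pow_eq_one h5
  rw [hx, ← hN] at h6
  exact Nat.dvd_of_mul_dvd_mul_right (Nat.gcd_pos_of_pos_left _ (by omega)) h6

theorem orderOf_mk_dvd_of_irreducible_charpoly {n N : ℕ}
    (hN : N * Nat.gcd n (Nat.card F - 1) = ∑ i ∈ Finset.range n, Nat.card F ^ i)
    (g : Matrix.SpecialLinearGroup (Fin n) F) (hg : Irreducible (g : Matrix (Fin n) (Fin n) F).charpoly) :
    orderOf (g : Matrix.ProjectiveSpecialLinearGroup (Fin n) F) ∣ N := by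
  have h := hg.dvd_X_pow_geom_sum_sub_C (Matrix.charpoly_monic _)
  have hdet := Matrix.det_eq_sign_charpoly_coeff (g : Matrix (Fin n) (Fin n) F)
  rw [Matrix.SpecialLinearGroup.det_coe, Fintype.card_fin] at hdet
  rw [Matrix.charpoly_natDegree_eq_dim, Fintype.card_fin, ← hdet, ← hN] at h
  obtain ⟨e, he⟩ := Nat.gcd_dvd_right n (Nat.card F - 1)
  have h1 := dvd_X_pow_mul_sub_C h e
  rw [mul_assoc, ← he, one_pow, C_1] at h1
  obtain ⟨c, hc⟩ := hg.exists_dvd_X_pow_sub_C h1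
  exact (orderOf_mk_dvd_iff g N).2 ⟨c, Matrix.pow_eq_scalar_of_charpoly_dvd hc⟩

theorem orderOf_mk_dvd_of_charpoly_eq_mul {n N : ℕ} (hn : 2 ≤ n)
    (hN : N * Nat.gcd n (Nat.card F - 1) = Nat.card F ^ (n - 1) - 1)
    (g : Matrix.SpecialLinearGroup (Fin n) F) {f : F[X]} {a : F} (hf : Irreducible f)
    (hfm : f.Monic) (hg : (g : Matrix (Fin n) (Fin n) F).charpoly = f * (X - C a))
    (hcop : IsCoprime f (X - C a)) :
    orderOf (g : Matrix.ProjectiveSpecialLinearGroup (Fin n) F) ∣ N := by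
  have hq := two_le_natCard (F := F)
  have hdeg : f.natDegree = n - 1 := by
    have := Matrix.charpoly_natDegree_eq_dim (g : Matrix (Fin n) (Fin n) F)
    rw [hg, hfm.natDegree_mul (monic_X_sub_C a), natDegree_X_sub_C, Fintype.card_fin] at this
    omega
  have hdet := Matrix.det_eq_sign_charpoly_coeff (g : Matrix (Fin n) (Fin n) F)
  rw [Matrix.SpecialLinearGroup.det_coe, Fintype.card_fin, hg, mul_coeff_zero, coeff_sub,
    coeff_X_zero, coeff_C_zero, zero_sub] at hdet
  have hb := hf.dvd_X_pow_geom_sum_sub_C hfm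
  rw [hdeg] at hb
  set b := (-1) ^ (n - 1) * f.coeff 0 with hbdef
  have hba : b * a = 1 := by
    rw [hdet, hbdef]
    conv_rhs => rw [show n = n - 1 + 1 by omega, pow_succ]
    ring
  have hb0 : b ≠ 0 := left_ne_zero_of_mul_eq_one hba
  have h1 := dvd_X_pow_mul_sub_C hb (Nat.card F - 1)
  rw [geom_sum_mul_nat _ _ (by omega), pow_card_sub_one_eq_one_of_ne_zero hb0, ← hN] at h1
  obtain ⟨e, he⟩ := Nat.gcd_dvd_right n (Nat.card F - 1)
  have h2 := dvd_X_pow_mul_sub_C h1 e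
  rw [mul_assoc, ← he, one_pow, C_1] at h2
  obtain ⟨c, hc⟩ := hf.exists_dvd_X_pow_sub_C h2
  have hcd : c ^ Nat.gcd n (Nat.card F - 1) = 1 :=
    eq_of_dvd_X_pow_sub_C hf.not_isUnit (dvd_X_pow_mul_sub_C hc _) h1
  have hcn : c ^ n = 1 := orderOf_dvd_iff_pow_eq_one.1
    ((orderOf_dvd_of_pow_eq_one hcd).trans (Nat.gcd_dvd_left _ _))
  have hcq : c ^ (Nat.card F - 1) = 1 := orderOf_dvd_iff_pow_eq_one.1
    ((orderOf_dvd_of_pow_eq_one hcd).trans (Nat.gcd_dvd_right _ _))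
  have hbc : b ^ N = c ^ (n - 1) := by
    have h3 := dvd_X_pow_mul_sub_C hb N
    have h4 := dvd_X_pow_mul_sub_C hc (∑ i ∈ Finset.range (n - 1), Nat.card F ^ i)
    rw [mul_comm] at h4
    rw [eq_of_dvd_X_pow_sub_C hf.not_isUnit h3 h4]
    exact pow_eq_pow_of_modEq (geom_sum_modEq _ _ _ (by omega) dvd_rfl) hcq
  have hac : a ^ N = c := by
    have h3 : b ^ N * a ^ N = 1 := by rw [← mul_pow, hba, one_pow]
    have h4 : b ^ N * c = 1 := by rw [hbc, ← pow_succ, Nat.sub_add_cancel (by omega), hcn]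
    exact mul_left_cancel₀ (pow_ne_zero N hb0) (h3.trans h4.symm)
  refine (orderOf_mk_dvd_iff g N).2 ⟨c, Matrix.pow_eq_scalar_of_charpoly_dvd ?_⟩
  rw [hg]
  refine hcop.mul_dvd hc ?_
  rw [← hac, C_pow]
  exact sub_dvd_pow_sub_pow _ _ _

theorem orderOf_coe_of_mk {F : Type*} [Field F] {n m : ℕ} (g : Matrix.SpecialLinearGroup (Fin n) F)
    (h : m ∣ orderOf (g : Matrix.ProjectiveSpecialLinearGroup (Fin n) F)) :
    m ∣ orderOf (g : Matrix (Fin n) (Fin n) F) := by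
  refine h.trans ((orderOf_mk_dvd_iff g _).2 ⟨1, ?_⟩)
  rw [pow_orderOf_eq_one, map_one]

theorem ne_char_of_pow_dvd_natCard_pow_sub_one (p : ℕ) [Fact p.Prime] [CharP F p] {l b n : ℕ}
    (hn : n ≠ 0) (hl : l.Prime) (hb : b ≠ 0) (h : l ^ b ∣ Nat.card F ^ n - 1) : l ≠ p := by
  rintro rfl
  have h1 : l ∣ Nat.card F ^ n := by
    refine dvd_pow ?_ hn
    have := Fintype.ofFinite F
    obtain ⟨k, -, hk⟩ := FiniteField.card F l
    rw [Nat.card_eq_fintype_card, hk]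
    exact dvd_pow_self _ k.ne_zero
  have h2 := Nat.dvd_sub h1 ((dvd_pow_self l hb).trans h)
  rw [Nat.sub_sub_self (Nat.one_le_pow _ _ Nat.card_pos)] at h2
  exact hl.one_lt.ne' (Nat.dvd_one.1 h2)

theorem orderOf_dvd_of_dvd_orderOf_of_norm_one (p : ℕ) [Fact p.Prime] [CharP F p] {n N : ℕ} (hn : 2 ≤ n)
    (h23 : ¬ (n = 2 ∧ Nat.card F = 3))
    (hN : N * Nat.gcd n (Nat.card F - 1) = ∑ i ∈ Finset.range n, Nat.card F ^ i)
    (g : Matrix.ProjectiveSpecialLinearGroup (Fin n) F) (hg : N ∣ orderOf g) :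
    orderOf g ∣ N := by
  obtain ⟨g, rfl⟩ := QuotientGroup.mk_surjective g
  have hq := two_le_natCard (F := F)
  obtain ⟨l, b, hl, hlN, hlb⟩ := exists_prime_pow_dvd_of_mul_gcd_eq_geom_sum hq hn h23 hN
  have hb : b ≠ 0 := by rintro rfl; exact hlb 1 (by omega) (by omega) (by simp)
  have hlp := ne_char_of_pow_dvd_natCard_pow_sub_one (F := F) p (n := n) (by omega) hl hb (by
    rw [← geom_sum_mul_nat _ _ (by omega), ← hN]
    exact (hlN.mul_right _).mul_right _)
  obtain ⟨f, hf, hfm, hfd, hfl⟩ := Matrix.exists_irreducible_dvd_charpoly (p := p)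
    (M := (g : Matrix (Fin n) (Fin n) F)) (by simp) hl hb hlp (orderOf_coe_of_mk g (hlN.trans hg))
  refine orderOf_mk_dvd_of_irreducible_charpoly hN g ?_
  have hdeg : n ≤ f.natDegree := by
    by_contra! hlt
    exact hlb _ hf.natDegree_pos hlt hfl
  rwa [eq_of_monic_of_dvd_of_natDegree_le hfm (Matrix.charpoly_monic _) hfd
    (by rwa [Matrix.charpoly_natDegree_eq_dim, Fintype.card_fin])]

theorem exists_charpoly_eq_mul_X_sub_C {F : Type*} [Field F] {n : ℕ} (M : Matrix (Fin n) (Fin n) F) {f : F[X]}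
    (hfm : f.Monic) (hf : f.natDegree + 1 = n) (hd : f ∣ M.charpoly) :
    ∃ a : F, M.charpoly = f * (X - C a) := by
  obtain ⟨h, hh⟩ := hd
  have hm : h.Monic := hfm.of_mul_monic_left (hh ▸ M.charpoly_monic)
  have hdeg : h.natDegree = 1 := by
    have := M.charpoly_natDegree_eq_dim
    rw [hh, hfm.natDegree_mul hm, Fintype.card_fin] at this
    omega
  refine ⟨-h.coeff 0, ?_⟩
  rw [hh, C_neg, sub_neg_eq_add, ← hm.eq_X_add_C hdeg]

theorem orderOf_dvd_of_dvd_orderOf_of_hyperplane (p : ℕ) [Fact p.Prime] [CharP F p] {n N : ℕ} (hn : 2 ≤ n)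
    (h22 : ¬ (n = 2 ∧ Nat.card F = 2)) (h23 : ¬ (n = 2 ∧ Nat.card F = 3))
    (hN : N * Nat.gcd n (Nat.card F - 1) = Nat.card F ^ (n - 1) - 1)
    (g : Matrix.ProjectiveSpecialLinearGroup (Fin n) F) (hg : N ∣ orderOf g) :
    orderOf g ∣ N := by
  obtain ⟨g, rfl⟩ := QuotientGroup.mk_surjective g
  have hq := two_le_natCard (F := F)
  rcases hn.eq_or_lt with rfl | hn3
  · have hq4 : 4 ≤ Nat.card F := by omega
    have hd : Nat.gcd 2 (Nat.card F - 1) ∣ 2 := Nat.gcd_dvd_left _ _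
    have hd2 := Nat.le_of_dvd two_pos hd
    have hdp : 0 < Nat.gcd 2 (Nat.card F - 1) := Nat.gcd_pos_of_pos_left _ two_pos
    simp only [Nat.add_one_sub_one, pow_one] at hN
    obtain ⟨f, hfm, hf, hfd⟩ := exists_monic_irreducible_factor (g : Matrix (Fin 2) (Fin 2) F).charpoly
      (fun hu => by
        have := natDegree_eq_zero_of_isUnit hu
        rw [Matrix.charpoly_natDegree_eq_dim] at this
        simp at this)
    have hdeg : f.natDegree ≤ 2 := by
      simpa using natDegree_le_of_dvd hfd (Matrix.charpoly_monic _).ne_zero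
    have hpos := hf.natDegree_pos
    rcases (show f.natDegree = 1 ∨ f.natDegree = 2 by omega) with h1 | h2
    · obtain ⟨a, ha⟩ := exists_charpoly_eq_mul_X_sub_C _ hfm (by omega) hfd
      by_cases hcop : IsCoprime f (X - C a)
      · exact orderOf_mk_dvd_of_charpoly_eq_mul hn (by simpa using hN) g hf hfm ha hcop
      · exfalso
        have hdvd := ((hf.coprime_iff_not_dvd).not_left.1 hcop)
        have hfa : f = X - C a := eq_of_monic_of_associated hfm (monic_X_sub_C a)
          (hf.associated_of_dvd (irreducible_X_sub_C a) hdvd)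
        have hp2 : 2 ≤ p := (Fact.out : p.Prime).two_le
        have h3 : (g : Matrix (Fin 2) (Fin 2) F).charpoly ∣ X ^ p - C (a ^ p) := by
          rw [ha, hfa, ← sq, C_pow, ← sub_pow_char]
          exact pow_dvd_pow _ hp2
        have h4 := hg.trans ((orderOf_mk_dvd_iff g p).2
          ⟨_, Matrix.pow_eq_scalar_of_charpoly_dvd h3⟩)
        rcases (Nat.dvd_prime Fact.out).1 h4 with h5 | h5
        · rw [h5] at hN
          omega
        · refine ne_char_of_pow_dvd_natCard_pow_sub_one (F := F) p (n := 1) one_ne_zero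
            (Fact.out : p.Prime) one_ne_zero ?_ rfl
          rw [pow_one, pow_one, ← hN, h5]
          exact dvd_mul_right _ _
    · exfalso
      have hirr : Irreducible (g : Matrix (Fin 2) (Fin 2) F).charpoly := by
        rwa [eq_of_monic_of_dvd_of_natDegree_le hfm (Matrix.charpoly_monic _) hfd
          (by rw [Matrix.charpoly_natDegree_eq_dim, Fintype.card_fin, h2])]
      have hdq : Nat.gcd 2 (Nat.card F - 1) ∣ ∑ i ∈ Finset.range 2, Nat.card F ^ i := by
        rw [(geom_sum_modEq _ _ _ (by omega) (Nat.gcd_dvd_right 2 (Nat.card F - 1))).dvd_iff dvd_rfl]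
        exact hd
      obtain ⟨N', hN'⟩ := hdq
      have h3 := hg.trans (orderOf_mk_dvd_of_irreducible_charpoly (N := N')
        (by rw [hN', mul_comm]) g hirr)
      have h4 := mul_dvd_mul_right h3 (Nat.gcd 2 (Nat.card F - 1))
      rw [hN, mul_comm, ← hN'] at h4
      simp only [Finset.sum_range_succ, Finset.sum_range_zero, pow_zero, pow_one, zero_add] at h4
      have h5 := Nat.dvd_sub h4 dvd_rfl
      rw [show 1 + Nat.card F - (Nat.card F - 1) = 2 by omega] at h5
      have := Nat.le_of_dvd two_pos h5
      omega
  · obtain ⟨l, b, hl, hlN, hlb⟩ := exists_prime_pow_dvd_of_mul_eq_pow_sub_one hq (by omega) (Nat.gcd_dvd_right _ _) hN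
    have hb : b ≠ 0 := by rintro rfl; exact hlb 1 (by omega) (by omega) (by simp)
    have hlq : l ^ b ∣ Nat.card F ^ (n - 1) - 1 := by
      rw [← hN]
      exact hlN.mul_right _
    have hlp := ne_char_of_pow_dvd_natCard_pow_sub_one (F := F) p (by omega) hl hb hlq
    obtain ⟨f, hf, hfm, hfd, hfl⟩ := Matrix.exists_irreducible_dvd_charpoly (p := p)
      (M := (g : Matrix (Fin n) (Fin n) F)) (by simp) hl hb hlp (orderOf_coe_of_mk g (hlN.trans hg))
    have hle : f.natDegree ≤ n := by
      simpa using natDegree_le_of_dvd hfd (Matrix.charpoly_monic _).ne_zero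
    have hge : n - 1 ≤ f.natDegree := by
      by_contra! hlt
      exact hlb _ hf.natDegree_pos hlt hfl
    have hne : f.natDegree ≠ n := by
      intro h
      have h1 := Nat.dvd_gcd hfl hlq
      rw [Nat.pow_sub_one_gcd_pow_sub_one, h] at h1
      refine hlb _ (Nat.gcd_pos_of_pos_left _ (by omega)) ?_ h1
      have h3 : Nat.gcd n (n - 1) = 1 := by
        have := (Nat.coprime_self_add_left (m := n - 1) (n := 1)).2 (by simp)
        rwa [Nat.sub_add_cancel (by omega)] at this
      omega
    obtain ⟨a, ha⟩ := exists_charpoly_eq_mul_X_sub_C _ hfm (by omega) hfd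
    refine orderOf_mk_dvd_of_charpoly_eq_mul hn hN g hf hfm ha
      ((hf.coprime_iff_not_dvd).2 fun hdvd => ?_)
    have := natDegree_le_of_dvd hdvd (X_sub_C_ne_zero a)
    rw [natDegree_X_sub_C] at this
    omega
end

theorem exists_orderOf_mul_of_subset {G : Type*} [Group G] {r : ℕ} [NeZero r]
    (h : groupSpectrum (Multiplicative (ZMod r) × G) ⊆ groupSpectrum G) (g : G) :
    ∃ g' : G, r ∣ orderOf g' ∧ orderOf g ∣ orderOf g' := by
  obtain ⟨g', hg'⟩ := h ⟨(Multiplicative.ofAdd (1 : ZMod r), g), rfl⟩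
  refine ⟨g', ?_⟩
  rw [hg', Prod.orderOf_mk, orderOf_ofAdd_eq_addOrderOf, ZMod.addOrderOf_one]
  exact ⟨Nat.dvd_lcm_left _ _, Nat.dvd_lcm_right _ _⟩

/-- For a prime `r` and a simple group `L = PSL_n(q)`, the spectrum of `Z_r × L` is not
contained in the spectrum of `L`. -/
theorem spectrum_prod_not_subset (r : ℕ) (hr : r.Prime)
    (p m q n : ℕ) (hp : p.Prime) (hm : 0 < m) (hq : q = p ^ m) (hn : 2 ≤ n)
    (h22 : ¬ (n = 2 ∧ q = 2)) (h23 : ¬ (n = 2 ∧ q = 3))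
    (F : Type*) [Field F] [Fintype F] (hF : Fintype.card F = q) :
    ¬ (groupSpectrum (Multiplicative (ZMod r) × Matrix.ProjectiveSpecialLinearGroup (Fin n) F) ⊆
        groupSpectrum (Matrix.ProjectiveSpecialLinearGroup (Fin n) F)) := by
  intro hsub
  have : NeZero r := ⟨hr.ne_zero⟩
  have : Fact p.Prime := ⟨hp⟩
  have : CharP F p := charP_of_card_eq_prime_pow (hF.trans hq)
  rw [← Nat.card_eq_fintype_card] at hF
  subst hF
  have hq2 := two_le_natCard (F := F)
  have hd : Nat.gcd n (Nat.card F - 1) ∣ ∑ i ∈ Finset.range n, Nat.card F ^ i := by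
    rw [(geom_sum_modEq _ _ _ (by omega) (Nat.gcd_dvd_right n (Nat.card F - 1))).dvd_iff dvd_rfl]
    exact Nat.gcd_dvd_left _ _
  have hd' : Nat.gcd n (Nat.card F - 1) ∣ Nat.card F ^ (n - 1) - 1 := by
    rw [← geom_sum_mul_nat _ _ (by omega)]
    exact (Nat.gcd_dvd_right _ _).mul_left _
  obtain ⟨N₁, hN₁⟩ := hd
  obtain ⟨N₂, hN₂⟩ := hd'
  rw [mul_comm, eq_comm] at hN₁ hN₂
  refine not_prime_dvd_both hq2 hn hr hN₁ hN₂ ?_ ?_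
  · obtain ⟨g, hg⟩ := exists_dvd_orderOf_of_norm_one p (by omega) hN₁
    obtain ⟨g', hr', hg'⟩ := exists_orderOf_mul_of_subset hsub g
    exact hr'.trans (orderOf_dvd_of_dvd_orderOf_of_norm_one p hn h23 hN₁ g' (hg.trans hg'))
  · obtain ⟨g, hg⟩ := exists_dvd_orderOf_of_hyperplane p hn hN₂
    obtain ⟨g', hr', hg'⟩ := exists_orderOf_mul_of_subset hsub g
    exact hr'.trans (orderOf_dvd_of_dvd_orderOf_of_hyperplane p hn h22 h23 hN₂ g' (hg.trans hg'))
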